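/- arXiv:1411.1628 — 4 statements merged into one kernel-verified Lean document; each statement's English description precedes it below -/
import Mathlib

section
/- For all K, C ∈ 𝒦^d_0 with 0 ∈ int C and every j ∈ {1,…,d}, the successive inradii are reciprocals of successive outer radii with interchanged arguments: r_π^j(K,C) = R^π_j(C,K)^{-1} and r^π_j(K,C) = R_π^j(C,K)^{-1}. -/
open Set Bornology Pointwise

/-- The circumradius of `K` with respect to `C`:
`R(K,C) = inf_{x ∈ ℝ^d} inf {λ ≥ 0 : K ⊆ x + λC}`. -/
noncomputable def circ {d : ℕ} (K C : Set (Fin d → ℝ)) : ℝ :=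
  sInf {l : ℝ | 0 ≤ l ∧ ∃ x : Fin d → ℝ, K ⊆ x +ᵥ l • C}

/-- The inradius of `K` with respect to `C`:
`r(K,C) = sup_{x ∈ ℝ^d} sup {λ ≥ 0 : x + λC ⊆ K}`. -/
noncomputable def inrad {d : ℕ} (K C : Set (Fin d → ℝ)) : ℝ :=
  sSup {l : ℝ | 0 ≤ l ∧ ∃ x : Fin d → ℝ, x +ᵥ l • C ⊆ K}

/-- `inf_{x ∈ ℝ^d} inf {λ ≥ 0 : K ⊆ x + L + λC}` for a linear subspace `L`. -/
noncomputable def cylRad {d : ℕ} (K C : Set (Fin d → ℝ)) (L : Submodule ℝ (Fin d → ℝ)) : ℝ :=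
  sInf {l : ℝ | 0 ≤ l ∧ ∃ x : Fin d → ℝ, K ⊆ (x +ᵥ (L : Set (Fin d → ℝ))) + l • C}

/-- `R_π^j(K,C) = sup_{L ∈ ℒ^d_{d-j}} inf_{x} inf {λ ≥ 0 : K ⊆ x + L + λC}`. -/
noncomputable def RpiSup {d : ℕ} (j : ℕ) (K C : Set (Fin d → ℝ)) : ℝ :=
  sSup {r : ℝ | ∃ L : Submodule ℝ (Fin d → ℝ), Module.finrank ℝ L = d - j ∧ r = cylRad K C L}

/-- `R^π_j(K,C) = inf_{L ∈ ℒ^d_{d-j}} inf_{x} inf {λ ≥ 0 : K ⊆ x + L + λC}`. -/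
noncomputable def RpiInf {d : ℕ} (j : ℕ) (K C : Set (Fin d → ℝ)) : ℝ :=
  sInf {r : ℝ | ∃ L : Submodule ℝ (Fin d → ℝ), Module.finrank ℝ L = d - j ∧ r = cylRad K C L}

/-- `R_σ^j(K,C) = sup_{L ∈ ℒ^d_j} sup_{x ∈ ℝ^d} R(K ∩ (x+L), C)`. -/
noncomputable def RsigmaSup {d : ℕ} (j : ℕ) (K C : Set (Fin d → ℝ)) : ℝ :=
  sSup {r : ℝ | ∃ L : Submodule ℝ (Fin d → ℝ), Module.finrank ℝ L = j ∧
    ∃ x : Fin d → ℝ, r = circ (K ∩ (x +ᵥ (L : Set (Fin d → ℝ)))) C}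

/-- `R^σ_j(K,C) = inf_{L ∈ ℒ^d_j} sup_{x ∈ ℝ^d} R(K ∩ (x+L), C)`. -/
noncomputable def RsigmaInf {d : ℕ} (j : ℕ) (K C : Set (Fin d → ℝ)) : ℝ :=
  sInf {r : ℝ | ∃ L : Submodule ℝ (Fin d → ℝ), Module.finrank ℝ L = j ∧
    r = sSup {s : ℝ | ∃ x : Fin d → ℝ, s = circ (K ∩ (x +ᵥ (L : Set (Fin d → ℝ)))) C}}

/-- `r_π^j(K,C) = sup_{L ∈ ℒ^d_{d-j}} r(K + L, C)`. -/
noncomputable def rpiSup {d : ℕ} (j : ℕ) (K C : Set (Fin d → ℝ)) : ℝ :=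
  sSup {r : ℝ | ∃ L : Submodule ℝ (Fin d → ℝ), Module.finrank ℝ L = d - j ∧
    r = inrad (K + (L : Set (Fin d → ℝ))) C}

/-- `r^π_j(K,C) = inf_{L ∈ ℒ^d_{d-j}} r(K + L, C)`. -/
noncomputable def rpiInf {d : ℕ} (j : ℕ) (K C : Set (Fin d → ℝ)) : ℝ :=
  sInf {r : ℝ | ∃ L : Submodule ℝ (Fin d → ℝ), Module.finrank ℝ L = d - j ∧
    r = inrad (K + (L : Set (Fin d → ℝ))) C}

/-- `inf_{x ∈ ℝ^d} sup_{y ∈ ℝ^d} sup {λ ≥ 0 : y + λ(C ∩ (x+L)) ⊆ K}` for a linear subspace `L`. -/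
noncomputable def secInrad {d : ℕ} (K C : Set (Fin d → ℝ)) (L : Submodule ℝ (Fin d → ℝ)) : ℝ :=
  sInf {s : ℝ | ∃ x : Fin d → ℝ,
    s = sSup {l : ℝ | 0 ≤ l ∧ ∃ y : Fin d → ℝ, y +ᵥ l • (C ∩ (x +ᵥ (L : Set (Fin d → ℝ)))) ⊆ K}}

/-- `r_σ^j(K,C) = sup_{L ∈ ℒ^d_j} inf_x sup_y sup {λ ≥ 0 : y + λ(C ∩ (x+L)) ⊆ K}`. -/
noncomputable def rsigmaSup {d : ℕ} (j : ℕ) (K C : Set (Fin d → ℝ)) : ℝ :=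
  sSup {r : ℝ | ∃ L : Submodule ℝ (Fin d → ℝ), Module.finrank ℝ L = j ∧ r = secInrad K C L}

/-- `r^σ_j(K,C) = inf_{L ∈ ℒ^d_j} inf_x sup_y sup {λ ≥ 0 : y + λ(C ∩ (x+L)) ⊆ K}`. -/
noncomputable def rsigmaInf {d : ℕ} (j : ℕ) (K C : Set (Fin d → ℝ)) : ℝ :=
  sInf {r : ℝ | ∃ L : Submodule ℝ (Fin d → ℝ), Module.finrank ℝ L = j ∧ r = secInrad K C L}

/-- The ball intersection `bi(K,C,λ) = ⋂_{x ∈ K} (x - λC)`. -/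
noncomputable def ballInt {d : ℕ} (K C : Set (Fin d → ℝ)) (l : ℝ) : Set (Fin d → ℝ) :=
  ⋂ x ∈ K, x +ᵥ (-l) • C

/-- The ball hull `bh(K,C,λ) = ⋂ {x + λC : x ∈ ℝ^d, K ⊆ x + λC}`. -/
noncomputable def ballHull {d : ℕ} (K C : Set (Fin d → ℝ)) (l : ℝ) : Set (Fin d → ℝ) :=
  ⋂ x ∈ {x : Fin d → ℝ | K ⊆ x +ᵥ l • C}, x +ᵥ l • C

/-- The set of circumcenters `cc(K,C) = {x : K ⊆ x + R(K,C)·C}`. -/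
noncomputable def circCenters {d : ℕ} (K C : Set (Fin d → ℝ)) : Set (Fin d → ℝ) :=
  {x : Fin d → ℝ | K ⊆ x +ᵥ circ K C • C}

/-- The set of incenters `ic(K,C) = {x : x + r(K,C)·C ⊆ K}`. -/
noncomputable def inCenters {d : ℕ} (K C : Set (Fin d → ℝ)) : Set (Fin d → ℝ) :=
  {x : Fin d → ℝ | x +ᵥ inrad K C • C ⊆ K}

/-- The diameter `D(K,C) = sup {γ_C(x-y) : x, y ∈ K}` (with `γ_C` the Minkowski functional). -/
noncomputable def diam {d : ℕ} (K C : Set (Fin d → ℝ)) : ℝ :=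
  sSup {r : ℝ | ∃ x ∈ K, ∃ y ∈ K, r = gauge C (x - y)}

theorem Real.sSup_inv_of_pos {S : Set ℝ} (hS : ∀ s ∈ S, 0 < s) : sSup S⁻¹ = (sInf S)⁻¹ := by
  rcases S.eq_empty_or_nonempty with rfl | ⟨s₀, hs₀⟩
  · simp
  have hb : BddBelow S := ⟨0, fun s hs => (hS s hs).le⟩
  rcases (Real.sInf_nonneg fun s hs => (hS s hs).le).eq_or_lt with h0 | hpos
  · rw [← h0, inv_zero]
    refine Real.sSup_of_not_bddAbove ?_
    rintro ⟨u, hu⟩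
    have hle : ∀ s ∈ S, s⁻¹ ≤ u := fun s hs => hu (Set.inv_mem_inv.2 hs)
    have hu0 : 0 < u := (inv_pos.2 (hS s₀ hs₀)).trans_le (hle s₀ hs₀)
    have : u⁻¹ ≤ sInf S :=
      le_csInf ⟨s₀, hs₀⟩ fun s hs => (inv_le_comm₀ hu0 (hS s hs)).2 (hle s hs)
    have := inv_pos.2 hu0
    linarith
  · refine IsLUB.csSup_eq ⟨?_, ?_⟩ ⟨s₀⁻¹, Set.inv_mem_inv.2 hs₀⟩
    · intro t ht
      have ht' : t⁻¹ ∈ S := ht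
      exact (le_inv_comm₀ hpos (inv_pos.1 (hS _ ht'))).1 (csInf_le hb ht')
    · intro u hu
      have hle : ∀ s ∈ S, s⁻¹ ≤ u := fun s hs => hu (Set.inv_mem_inv.2 hs)
      have hu0 : 0 < u := (inv_pos.2 (hS s₀ hs₀)).trans_le (hle s₀ hs₀)
      exact (inv_le_comm₀ hu0 hpos).1
        (le_csInf ⟨s₀, hs₀⟩ fun s hs => (inv_le_comm₀ hu0 (hS s hs)).2 (hle s hs))

/-- A translate of `l • C` lies in `K + L` iff `C` lies in a cylinder over `l⁻¹ • K`. -/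
theorem exists_vadd_smul_subset_iff {d : ℕ} (K C : Set (Fin d → ℝ))
    (L : Submodule ℝ (Fin d → ℝ)) {l : ℝ} (hl : 0 < l) :
    (∃ x : Fin d → ℝ, x +ᵥ l • C ⊆ K + (L : Set (Fin d → ℝ))) ↔
      ∃ x : Fin d → ℝ, C ⊆ (x +ᵥ (L : Set (Fin d → ℝ))) + l⁻¹ • K := by
  constructor
  · rintro ⟨x, hx⟩
    refine ⟨-(l⁻¹ • x), fun c hc => ?_⟩
    obtain ⟨k, hk, m, hm, h⟩ :=
      Set.mem_add.1 (hx (Set.vadd_mem_vadd_set (Set.smul_mem_smul_set hc)))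
    refine Set.mem_add.2 ⟨_, Set.vadd_mem_vadd_set (L.smul_mem l⁻¹ hm), _,
      Set.smul_mem_smul_set hk, ?_⟩
    have h' := congrArg (fun v => l⁻¹ • v) h
    simp only [vadd_eq_add, smul_add, smul_smul, inv_mul_cancel₀ hl.ne', one_smul] at h' ⊢
    rw [add_assoc, add_comm (l⁻¹ • m), h']
    abel
  · rintro ⟨x, hx⟩
    refine ⟨-(l • x), ?_⟩
    rintro _ ⟨_, ⟨c, hc, rfl⟩, rfl⟩
    obtain ⟨_, ⟨m, hm, rfl⟩, _, ⟨k, hk, rfl⟩, h⟩ := Set.mem_add.1 (hx hc)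
    refine Set.mem_add.2 ⟨k, hk, _, L.smul_mem l hm, ?_⟩
    simp only [vadd_eq_add] at h ⊢
    rw [← h]
    simp only [smul_add, smul_smul, mul_inv_cancel₀ hl.ne', one_smul]
    abel

/-- A bounded set lies in a homothetic copy of any set with nonempty interior. -/
theorem exists_subset_vadd_add_smul {d : ℕ} {K C : Set (Fin d → ℝ)}
    (hK : (interior K).Nonempty) (hC : IsBounded C) (L : Submodule ℝ (Fin d → ℝ)) :
    ∃ l : ℝ, 0 ≤ l ∧ ∃ x : Fin d → ℝ, C ⊆ (x +ᵥ (L : Set (Fin d → ℝ))) + l • K := by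
  obtain ⟨k, hk⟩ := hK
  obtain ⟨ε, hε, hball⟩ := Metric.mem_nhds_iff.1 (mem_interior_iff_mem_nhds.1 hk)
  obtain ⟨R, hR, hCR⟩ := hC.exists_pos_norm_lt
  have hl : 0 < R / ε := div_pos hR hε
  refine ⟨R / ε, hl.le, -((R / ε) • k), fun c hc => ?_⟩
  refine Set.mem_add.2 ⟨_, Set.vadd_mem_vadd_set L.zero_mem, _,
    Set.smul_mem_smul_set (a := R / ε) (b := k + (R / ε)⁻¹ • c) (hball ?_), ?_⟩
  · rw [mem_ball_iff_norm, add_sub_cancel_left, norm_smul, Real.norm_of_nonneg (inv_nonneg.2 hl.le),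
      inv_mul_lt_iff₀ hl, div_mul_cancel₀ _ hε.ne']
    exact hCR c hc
  · simp only [vadd_eq_add, add_zero, smul_add, smul_smul, mul_inv_cancel₀ hl.ne', one_smul,
      neg_add_cancel_left]

/-- A set with interior cannot be covered by thin cylinders with a proper direction space. -/
theorem exists_pos_le_of_subset_vadd_add_smul {d : ℕ} {K C : Set (Fin d → ℝ)}
    (hK : IsBounded K) (hC : (0 : Fin d → ℝ) ∈ interior C)
    {L : Submodule ℝ (Fin d → ℝ)} (hL : L < ⊤) :
    ∃ δ : ℝ, 0 < δ ∧ ∀ l : ℝ, 0 ≤ l →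
      (∃ x : Fin d → ℝ, C ⊆ (x +ᵥ (L : Set (Fin d → ℝ))) + l • K) → δ ≤ l := by
  obtain ⟨f, hf0, hLf⟩ := L.exists_le_ker_of_lt_top hL
  obtain ⟨v, hv⟩ : ∃ v, 0 < f v := by
    obtain ⟨v, hv⟩ := DFunLike.ne_iff.1 hf0
    rcases lt_or_gt_of_ne hv with h | h
    · exact ⟨-v, by simpa using h⟩
    · exact ⟨v, h⟩
  obtain ⟨M, hM, hKM⟩ := hK.exists_pos_norm_le
  obtain ⟨ε, hε, hεC⟩ : ∃ ε : ℝ, 0 < ε ∧ ε • v ∈ C := by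
    have hcont : Filter.Tendsto (fun t : ℝ => t • v) (nhds 0) (nhds 0) :=
      (continuous_id.smul continuous_const).tendsto' _ _ (zero_smul ℝ v)
    have h : ∀ᶠ t : ℝ in nhdsWithin 0 (Set.Ioi 0), t • v ∈ C :=
      nhdsWithin_le_nhds (hcont (mem_interior_iff_mem_nhds.1 hC))
    have hpos : ∀ᶠ t : ℝ in nhdsWithin 0 (Set.Ioi 0), 0 < t := self_mem_nhdsWithin
    exact (hpos.and h).exists
  let g := LinearMap.toContinuousLinearMap f
  have hg : ∀ k ∈ K, |f k| ≤ (‖g‖ + 1) * M := fun k hk => by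
    refine (g.le_opNorm k).trans ?_
    exact mul_le_mul (by linarith) (hKM k hk) (norm_nonneg k) (by positivity)
  set B : ℝ := (‖g‖ + 1) * M with hB
  have hB0 : 0 < B := by positivity
  refine ⟨ε * f v / (2 * B), by positivity, ?_⟩
  rintro l hl ⟨x, hx⟩
  have key : ∀ c ∈ C, ∃ k ∈ K, f c = f x + l * f k := fun c hc => by
    obtain ⟨_, ⟨m, hm, rfl⟩, _, ⟨k, hk, rfl⟩, h⟩ := Set.mem_add.1 (hx hc)
    have hm0 : f m = 0 := hLf hm
    exact ⟨k, hk, by simp [← h, hm0]⟩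
  obtain ⟨k, hk, h₁⟩ := key 0 (interior_subset hC)
  obtain ⟨k', hk', h₂⟩ := key _ hεC
  rw [map_zero] at h₁
  rw [map_smul, smul_eq_mul] at h₂
  rw [div_le_iff₀ (by positivity)]
  have h₃ := (abs_le.1 (hg k hk)).1
  have h₄ := (abs_le.1 (hg k' hk')).2
  have := mul_le_mul_of_nonneg_left (show f k' - f k ≤ 2 * B by linarith) hl
  linarith

theorem cylRad_pos {d : ℕ} {K C : Set (Fin d → ℝ)}
    (hKint : (interior K).Nonempty) (hK : IsBounded K) (hC : IsBounded C)
    (hC0 : (0 : Fin d → ℝ) ∈ interior C) {L : Submodule ℝ (Fin d → ℝ)} (hL : L < ⊤) :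
    0 < cylRad C K L := by
  obtain ⟨δ, hδ, h⟩ := exists_pos_le_of_subset_vadd_add_smul hK hC0 hL
  exact hδ.trans_le (le_csInf (exists_subset_vadd_add_smul hKint hC L) fun l hl => h l hl.1 hl.2)

theorem inrad_add_eq_inv_cylRad {d : ℕ} {K C : Set (Fin d → ℝ)}
    (hKint : (interior K).Nonempty) (hK : IsBounded K) (hC : IsBounded C)
    (hC0 : (0 : Fin d → ℝ) ∈ interior C) {L : Submodule ℝ (Fin d → ℝ)} (hL : L < ⊤) :
    inrad (K + (L : Set (Fin d → ℝ))) C = (cylRad C K L)⁻¹ := by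
  have hm := cylRad_pos hKint hK hC hC0 hL
  obtain ⟨δ, hδ, hδle⟩ := exists_pos_le_of_subset_vadd_add_smul hK hC0 hL
  have hpos : ∀ l ∈ {l : ℝ | 0 ≤ l ∧ ∃ x : Fin d → ℝ, C ⊆ (x +ᵥ (L : Set (Fin d → ℝ))) + l • K},
      0 < l := fun l hl => hδ.trans_le (hδle l hl.1 hl.2)
  have hinv : {l : ℝ | 0 ≤ l ∧ ∃ x : Fin d → ℝ, C ⊆ (x +ᵥ (L : Set (Fin d → ℝ))) + l • K}⁻¹ ⊆
      {l : ℝ | 0 ≤ l ∧ ∃ x : Fin d → ℝ, x +ᵥ l • C ⊆ K + (L : Set (Fin d → ℝ))} := by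
    intro l hl
    have h0 : 0 < l := inv_pos.1 (hpos _ hl)
    exact ⟨h0.le, (exists_vadd_smul_subset_iff K C L h0).2 hl.2⟩
  obtain ⟨b, hb⟩ := exists_subset_vadd_add_smul hKint hC L
  refine IsLUB.csSup_eq ⟨?_, ?_⟩ ⟨b⁻¹, hinv (Set.inv_mem_inv.2 hb)⟩
  · rintro l ⟨hl0, hl⟩
    rcases hl0.eq_or_lt with rfl | h0
    · exact (inv_pos.2 hm).le
    · exact (le_inv_comm₀ hm h0).1 (csInf_le ⟨0, fun _ h => h.1⟩
        ⟨inv_nonneg.2 hl0, (exists_vadd_smul_subset_iff K C L h0).1 hl⟩)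
  · intro u hu
    rw [cylRad, ← Real.sSup_inv_of_pos hpos]
    exact csSup_le ⟨b⁻¹, Set.inv_mem_inv.2 hb⟩ fun t ht => hu (hinv ht)

/-- `r_π^j(K,C) = R^π_j(C,K)⁻¹` and `r^π_j(K,C) = R_π^j(C,K)⁻¹`. -/
theorem rpi_eq_inv_Rpi (d : ℕ) (hd : 1 ≤ d) (K C : Set (Fin d → ℝ))
    (hKcp : IsCompact K) (hKcv : Convex ℝ K) (hKint : (interior K).Nonempty)
    (hCcp : IsCompact C) (hCcv : Convex ℝ C) (hCint : (interior C).Nonempty)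
    (hC0 : (0 : Fin d → ℝ) ∈ interior C)
    (j : ℕ) (hj1 : 1 ≤ j) (hjd : j ≤ d) :
    rpiSup j K C = (RpiInf j C K)⁻¹ ∧ rpiInf j K C = (RpiSup j C K)⁻¹ := by
  have hlt : ∀ L : Submodule ℝ (Fin d → ℝ), Module.finrank ℝ L = d - j → L < ⊤ := by
    rintro L hL
    refine lt_top_iff_ne_top.2 ?_
    rintro rfl
    rw [finrank_top, Module.finrank_fin_fun] at hL
    omega
  have hrad := fun L hL =>
    inrad_add_eq_inv_cylRad hKint hKcp.isBounded hCcp.isBounded hC0 (hlt L hL)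
  have hpos : ∀ r ∈ {r : ℝ | ∃ L : Submodule ℝ (Fin d → ℝ),
      Module.finrank ℝ L = d - j ∧ r = cylRad C K L}, 0 < r := by
    rintro _ ⟨L, hL, rfl⟩
    exact cylRad_pos hKint hKcp.isBounded hCcp.isBounded hC0 (hlt L hL)
  have hset : {r : ℝ | ∃ L : Submodule ℝ (Fin d → ℝ), Module.finrank ℝ L = d - j ∧
      r = inrad (K + (L : Set (Fin d → ℝ))) C} = {r : ℝ | ∃ L : Submodule ℝ (Fin d → ℝ),
      Module.finrank ℝ L = d - j ∧ r = cylRad C K L}⁻¹ := by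
    ext r
    simp only [Set.mem_inv, Set.mem_ofPred_eq]
    refine exists_congr fun L => and_congr_right fun hL => ?_
    rw [hrad L hL, inv_eq_iff_eq_inv]
  constructor
  · rw [rpiSup, RpiInf, hset, Real.sSup_inv_of_pos hpos]
  · rw [rpiInf, RpiSup, hset, ← inv_inj, inv_inv, ← Real.sSup_inv_of_pos, inv_inv]
    exact fun s hs => inv_pos.1 (hpos _ hs)
end

section
/- Let K ⊆ ℝ^d be bounded, C ∈ 𝒦^d_0 with 0 ∈ int C, and λ ≥ R(K,C). If bh(K,C,λ) ≠ ∅ and bi(K,C,λ) ≠ ∅, then the ball intersection of K equals the ball intersection of its ball hull: bi(K,C,λ) = bi(bh(K,C,λ), C, λ), i.e., ⋂_{x∈K} (x − λC) = ⋂_{x ∈ bh(K,C,λ)} (x − λC). -/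
open Set Bornology Pointwise

theorem mem_ballInt_iff_subset {d : ℕ} {K C : Set (Fin d → ℝ)} {l : ℝ} {p : Fin d → ℝ} :
    p ∈ ballInt K C l ↔ K ⊆ p +ᵥ l • C := by
  have key (x : Fin d → ℝ) : p ∈ x +ᵥ (-l) • C ↔ x ∈ p +ᵥ l • C := by
    rw [neg_smul_set, mem_vadd_set_iff_neg_vadd_mem, mem_vadd_set_iff_neg_vadd_mem, Set.mem_neg]
    simp only [vadd_eq_add, neg_add_rev, neg_neg]
  simp only [ballInt, mem_iInter₂, key, Set.subset_def]

theorem subset_ballHull {d : ℕ} (K C : Set (Fin d → ℝ)) (l : ℝ) : K ⊆ ballHull K C l :=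
  subset_iInter₂ fun _ hx => hx

theorem ballHull_subset {d : ℕ} {K C : Set (Fin d → ℝ)} {l : ℝ} {p : Fin d → ℝ}
    (hp : K ⊆ p +ᵥ l • C) : ballHull K C l ⊆ p +ᵥ l • C :=
  biInter_subset_of_mem (t := fun x : Fin d → ℝ => x +ᵥ l • C) hp

/-- the ball intersection of `K` equals the ball intersection of its ball hull. -/
theorem ballInt_eq_ballInt_ballHull (d : ℕ) (hd : 1 ≤ d) (K C : Set (Fin d → ℝ))
    (hKb : IsBounded K)
    (hCcp : IsCompact C) (hCcv : Convex ℝ C) (hC0 : (0 : Fin d → ℝ) ∈ interior C)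
    (l : ℝ) (hl : circ K C ≤ l)
    (hbh : (ballHull K C l).Nonempty) (hbi : (ballInt K C l).Nonempty) :
    ballInt K C l = ballInt (ballHull K C l) C l := by
  ext p
  rw [mem_ballInt_iff_subset, mem_ballInt_iff_subset]
  exact ⟨ballHull_subset, (subset_ballHull K C l).trans⟩
end

section
/- Let K ⊆ ℝ^d be bounded, C ∈ 𝒦^d_0 with 0 ∈ int C, and λ ≥ R(K,C). If the diameter of K with respect to C satisfies sup{γ_C(x−y) : x,y ∈ K} = λ, then bh(K,C,λ) ⊆ bi(K,−C,λ), i.e., the ball hull of K is contained in ⋂_{x∈K}(x + λC). -/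
open Set Bornology Pointwise

open Topology in
theorem gauge_le_iff_mem_smul {E : Type*} [NormedAddCommGroup E] [NormedSpace ℝ E] {C : Set E}
    (hCcp : IsCompact C) (hCcv : Convex ℝ C) (hC0 : C ∈ 𝓝 (0 : E)) {l : ℝ} (hl : 0 ≤ l) {v : E} :
    gauge C v ≤ l ↔ v ∈ l • C := by
  rcases hl.eq_or_lt with rfl | hpos
  · rw [zero_smul_set ⟨0, mem_of_mem_nhds hC0⟩, Set.mem_zero, ← not_lt,
      gauge_pos (absorbent_nhds_zero hC0)
        ((NormedSpace.isVonNBounded_iff ℝ).2 hCcp.isBounded), not_not]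
  · rw [mem_smul_set_iff_inv_smul_mem₀ hpos.ne', ← hCcp.isClosed.closure_eq,
      ← gauge_le_one_iff_mem_closure hCcv hC0, hCcp.isClosed.closure_eq,
      gauge_smul_of_nonneg (inv_nonneg.2 hl), smul_eq_mul, inv_mul_le_one₀ hpos]

open Topology in
theorem bddAbove_gauge_sub {E : Type*} [NormedAddCommGroup E] [NormedSpace ℝ E] [ProperSpace E]
    {K C : Set E} (hKb : IsBounded K) (hCcv : Convex ℝ C) (hC0 : C ∈ 𝓝 (0 : E)) :
    BddAbove {r : ℝ | ∃ x ∈ K, ∃ y ∈ K, r = gauge C (x - y)} := by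
  refine ((hKb.sub hKb).isCompact_closure.bddAbove_image
    (continuous_gauge hCcv hC0).continuousOn).mono ?_
  rintro _ ⟨x, hx, y, hy, rfl⟩
  exact mem_image_of_mem _ (subset_closure (sub_mem_sub hx hy))

/-- if the diameter of `K` w.r.t. `C` equals `λ`, then `bh(K,C,λ) ⊆ bi(K,-C,λ)`. -/
theorem ballHull_subset_ballInt_neg (d : ℕ) (hd : 1 ≤ d) (K C : Set (Fin d → ℝ))
    (hKb : IsBounded K)
    (hCcp : IsCompact C) (hCcv : Convex ℝ C) (hC0 : (0 : Fin d → ℝ) ∈ interior C)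
    (l : ℝ) (hl : circ K C ≤ l)
    (hdiam : sSup {r : ℝ | ∃ x ∈ K, ∃ y ∈ K, r = gauge C (x - y)} = l) :
    ballHull K C l ⊆ ballInt K (-C) l := by
  have hC : C ∈ nhds (0 : Fin d → ℝ) := mem_interior_iff_mem_nhds.1 hC0
  intro z hz
  refine mem_iInter₂.2 fun x hx => ?_
  rw [smul_set_neg, neg_smul_set, neg_neg]
  refine mem_iInter₂.1 hz x fun y hy => ?_
  have hle : gauge C (y - x) ≤ l :=
    (le_csSup (bddAbove_gauge_sub hKb hCcv hC) ⟨y, hy, x, hx, rfl⟩).trans_eq hdiam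
  rw [mem_vadd_set_iff_neg_vadd_mem, vadd_eq_add, neg_add_eq_sub]
  exact (gauge_le_iff_mem_smul hCcp hCcv hC ((gauge_nonneg _).trans hle)).1 hle
end

section
/- For all K, C ∈ 𝒦^d_0, the set of circumcenters cc(K,C) is nonempty, bounded, closed, and convex; and its interior is empty (equivalently, its dimension is at most d−1). -/
open Set Bornology Pointwise

theorem subset_vadd_smul_iff {d : ℕ} {K C : Set (Fin d → ℝ)} {x : Fin d → ℝ} {l : ℝ} :
    K ⊆ x +ᵥ l • C ↔ ∀ k ∈ K, k - x ∈ l • C := by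
  refine forall₂_congr fun k _ => ?_
  rw [Set.mem_vadd_set_iff_neg_vadd_mem, vadd_eq_add, neg_add_eq_sub]

/-- The graph of the dilates of a compact set is closed. -/
theorem IsCompact.isClosed_setOf_mem_smul {E : Type*} [NormedAddCommGroup E] [NormedSpace ℝ E]
    {C : Set E} (hC : IsCompact C) : IsClosed {p : ℝ × E | p.2 ∈ p.1 • C} := by
  have := isCompact_iff_compactSpace.mp hC
  have hclosed : IsClosed {q : C × (ℝ × E) | q.2.1 • (q.1 : E) = q.2.2} :=
    isClosed_eq (by fun_prop) (by fun_prop)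
  convert isClosedMap_snd_of_compactSpace _ hclosed using 1
  ext p
  simp [Set.mem_smul_set]

theorem isClosed_setOf_subset_vadd_smul {d : ℕ} (K : Set (Fin d → ℝ)) {C : Set (Fin d → ℝ)}
    (hC : IsCompact C) : IsClosed {p : ℝ × (Fin d → ℝ) | K ⊆ p.2 +ᵥ p.1 • C} := by
  simp only [subset_vadd_smul_iff, ofPred_forall]
  refine isClosed_biInter fun k _ => ?_
  have hcont : Continuous fun p : ℝ × (Fin d → ℝ) => (p.1, k - p.2) := by fun_prop
  exact hC.isClosed_setOf_mem_smul.preimage hcont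

/-- The centers of the dilates of `C` with ratio in a bounded interval that contain `K` form a
compact set. -/
theorem isCompact_setOf_subset_vadd_smul {d : ℕ} {K C : Set (Fin d → ℝ)} (hK : K.Nonempty)
    (hC : IsCompact C) (a b : ℝ) :
    IsCompact {p : ℝ × (Fin d → ℝ) | p.1 ∈ Icc a b ∧ K ⊆ p.2 +ᵥ p.1 • C} := by
  obtain ⟨k, hk⟩ := hK
  have himage : IsCompact ((fun q : ℝ × (Fin d → ℝ) => (q.1, k - q.1 • q.2)) '' Icc a b ×ˢ C) :=
    (isCompact_Icc.prod hC).image (by fun_prop)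
  refine himage.of_isClosed_subset
    ((isClosed_Icc.preimage continuous_fst).inter (isClosed_setOf_subset_vadd_smul K hC)) ?_
  rintro ⟨l, x⟩ ⟨hl, hx⟩
  obtain ⟨c, hc, hcx⟩ := subset_vadd_smul_iff.mp hx k hk
  refine ⟨(l, c), ⟨hl, hc⟩, Prod.ext rfl ?_⟩
  change k - l • c = x
  rw [show l • c = k - x from hcx, sub_sub_cancel]

theorem exists_subset_vadd_smul {d : ℕ} {K C : Set (Fin d → ℝ)} (hK : IsBounded K)
    (hC : (interior C).Nonempty) : ∃ l : ℝ, 0 ≤ l ∧ ∃ x : Fin d → ℝ, K ⊆ x +ᵥ l • C := by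
  obtain ⟨c, hc⟩ := hC
  obtain ⟨ε, hε, hball⟩ := Metric.mem_nhds_iff.mp (mem_interior_iff_mem_nhds.mp hc)
  obtain ⟨M, hM, hKM⟩ := hK.exists_pos_norm_lt
  have hl : 0 < M / ε := div_pos hM hε
  refine ⟨M / ε, hl.le, -((M / ε) • c), subset_vadd_smul_iff.mpr fun k hk => ?_⟩
  rw [Set.mem_smul_set_iff_inv_smul_mem₀ hl.ne']
  apply hball
  rw [sub_neg_eq_add, smul_add, inv_smul_smul₀ hl.ne', mem_ball_iff_norm, add_sub_cancel_right,
    norm_smul, norm_inv, Real.norm_of_nonneg hl.le, inv_mul_lt_iff₀ hl, div_mul_cancel₀ _ hε.ne']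
  exact hKM k hk

theorem circ_le {d : ℕ} {K C : Set (Fin d → ℝ)} {l : ℝ} {x : Fin d → ℝ} (hl : 0 ≤ l)
    (hx : K ⊆ x +ᵥ l • C) : circ K C ≤ l :=
  csInf_le ⟨0, fun _ h => h.1⟩ ⟨hl, x, hx⟩

theorem circ_nonneg {d : ℕ} (K C : Set (Fin d → ℝ)) : 0 ≤ circ K C :=
  Real.sInf_nonneg fun _ h => h.1

theorem circCenters_nonempty {d : ℕ} {K C : Set (Fin d → ℝ)} (hKb : IsBounded K)
    (hK : K.Nonempty) (hC : IsCompact C) (hCint : (interior C).Nonempty) :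
    (circCenters K C).Nonempty := by
  obtain ⟨L, hL, x, hx⟩ := exists_subset_vadd_smul hKb hCint
  obtain ⟨⟨r, y⟩, ⟨hr, hy⟩, hmin⟩ := (isCompact_setOf_subset_vadd_smul hK hC 0 L).exists_isMinOn
    ⟨(L, x), ⟨hL, le_rfl⟩, hx⟩ continuous_fst.continuousOn
  have hcirc : circ K C = r := by
    refine le_antisymm (circ_le hr.1 hy) (le_csInf ⟨L, hL, x, hx⟩ ?_)
    rintro l ⟨hl, z, hz⟩
    obtain hlL | hLl := le_total l L
    · exact hmin (show (l, z) ∈ _ from ⟨⟨hl, hlL⟩, hz⟩)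
    · exact hr.2.trans hLl
  exact ⟨y, by simpa only [circCenters, mem_ofPred_eq, hcirc] using hy⟩

theorem isCompact_circCenters {d : ℕ} {K C : Set (Fin d → ℝ)} (hK : K.Nonempty)
    (hC : IsCompact C) : IsCompact (circCenters K C) := by
  convert (isCompact_setOf_subset_vadd_smul hK hC (circ K C) (circ K C)).image continuous_snd
    using 1
  ext x
  simp [circCenters]

theorem convex_circCenters {d : ℕ} (K : Set (Fin d → ℝ)) {C : Set (Fin d → ℝ)}
    (hC : Convex ℝ C) : Convex ℝ (circCenters K C) := by
  intro x hx y hy a b ha hb hab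
  refine subset_vadd_smul_iff.mpr fun k hk => ?_
  convert hC.smul (circ K C) (subset_vadd_smul_iff.mp hx k hk) (subset_vadd_smul_iff.mp hy k hk)
    ha hb hab using 1
  rw [smul_sub, smul_sub, sub_add_sub_comm, ← add_smul, hab, one_smul]

theorem circ_pos {d : ℕ} (hd : 1 ≤ d) {K C : Set (Fin d → ℝ)} (hKint : (interior K).Nonempty)
    (hcc : (circCenters K C).Nonempty) : 0 < circ K C := by
  refine (circ_nonneg K C).lt_of_ne fun h => ?_
  have : Nonempty (Fin d) := ⟨⟨0, hd⟩⟩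
  obtain ⟨x, hx⟩ := hcc
  rw [circCenters, mem_ofPred_eq, ← h] at hx
  have hsub : K ⊆ {x} := fun k hk => by
    simpa [sub_eq_zero] using zero_smul_set_subset C (subset_vadd_smul_iff.mp hx k hk)
  simpa using hKint.mono (interior_mono hsub)

theorem interior_circCenters {d : ℕ} {K C : Set (Fin d → ℝ)} (hK : IsBounded K)
    (hpos : 0 < circ K C) : interior (circCenters K C) = ∅ := by
  refine eq_empty_of_forall_notMem fun x hx => ?_
  obtain ⟨ε, hε, hball⟩ := Metric.mem_nhds_iff.mp (mem_interior_iff_mem_nhds.mp hx)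
  obtain ⟨M, hM, hKM⟩ := (hK.vadd (-x)).exists_pos_norm_lt
  have hs : 0 < 1 + ε / M := by positivity
  have hlt : (1 + ε / M)⁻¹ * circ K C < circ K C :=
    mul_lt_of_lt_one_left hpos (inv_lt_one_of_one_lt₀ (by simpa using div_pos hε hM))
  refine hlt.not_ge (circ_le (x := x) (by positivity) (subset_vadd_smul_iff.mpr fun k hk => ?_))
  have hnorm : ‖k - x‖ < M := by
    simpa [neg_add_eq_sub] using hKM _ (vadd_mem_vadd_set (a := -x) hk)
  have hmem : x - (ε / M) • (k - x) ∈ circCenters K C := by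
    apply hball
    rw [mem_ball_iff_norm, sub_sub_cancel_left, norm_neg, norm_smul,
      Real.norm_of_nonneg (by positivity), div_mul_eq_mul_div, div_lt_iff₀ hM]
    gcongr
  rw [mul_smul, Set.mem_smul_set_iff_inv_smul_mem₀ (inv_ne_zero hs.ne'), inv_inv]
  convert subset_vadd_smul_iff.mp hmem k hk using 1
  module

/-- `cc(K,C)` is nonempty, bounded, closed, convex, and has empty interior. -/
theorem circCenters_properties (d : ℕ) (hd : 1 ≤ d) (K C : Set (Fin d → ℝ))
    (hKcp : IsCompact K) (hKcv : Convex ℝ K) (hKint : (interior K).Nonempty)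
    (hCcp : IsCompact C) (hCcv : Convex ℝ C) (hCint : (interior C).Nonempty) :
    (circCenters K C).Nonempty ∧ IsBounded (circCenters K C) ∧
      IsClosed (circCenters K C) ∧ Convex ℝ (circCenters K C) ∧
      interior (circCenters K C) = ∅ := by
  have hK : K.Nonempty := hKint.mono interior_subset
  have hcc := circCenters_nonempty hKcp.isBounded hK hCcp hCint
  have hcompact := isCompact_circCenters hK hCcp
  exact ⟨hcc, hcompact.isBounded, hcompact.isClosed, convex_circCenters K hCcv,
    interior_circCenters hKcp.isBounded (circ_pos hd hKint hcc)⟩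
end
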